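/- Let K be a field, q a quadratic form over K, and L a finite extension of K of odd degree. If q has a nontrivial zero over L, then q has a nontrivial zero over K. -/

import Mathlib

open Polynomial

namespace Polynomial

theorem natDegree_prod_pow_le_and_coeff {R σ : Type*} [CommSemiring R] (s : Finset σ)
    (g : σ → R[X]) (e : σ → ℕ) {m : ℕ} (hg : ∀ i, (g i).natDegree ≤ m) :
    (∏ i ∈ s, g i ^ e i).natDegree ≤ (∑ i ∈ s, e i) * m ∧
      (∏ i ∈ s, g i ^ e i).coeff ((∑ i ∈ s, e i) * m) = ∏ i ∈ s, (g i).coeff m ^ e i := by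
  classical
  induction s using Finset.induction_on with
  | empty => simp
  | insert a s ha ih =>
    have hpow : (g a ^ e a).natDegree ≤ e a * m := natDegree_pow_le_of_le _ (hg a)
    rw [Finset.prod_insert ha, Finset.sum_insert ha, Finset.prod_insert ha, add_mul]
    refine ⟨natDegree_mul_le_of_le hpow ih.1, ?_⟩
    rw [coeff_mul_add_eq_of_natDegree_le hpow ih.1, ih.2, coeff_pow_of_natDegree_le (hg a)]

theorem exists_irreducible_dvd_odd_natDegree {F : Type*} [Field F] {f : F[X]}
    (hf : Odd f.natDegree) : ∃ p : F[X], Irreducible p ∧ p ∣ f ∧ Odd p.natDegree := by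
  induction f using WfDvdMonoid.induction_on_irreducible with
  | zero => simp at hf
  | unit u hu => simp [natDegree_eq_zero_of_isUnit hu] at hf
  | mul a i ha hi ih =>
    by_cases hodd : Odd i.natDegree
    · exact ⟨i, hi, dvd_mul_right _ _, hodd⟩
    · rw [natDegree_mul hi.ne_zero ha] at hf
      obtain ⟨p, hp, hpa, hpo⟩ := ih (by grind)
      exact ⟨p, hp, hpa.mul_left i, hpo⟩

end Polynomial

namespace MvPolynomial

theorem dvd_aeval_mod_iff {σ F : Type*} [Field F] (q : MvPolynomial σ F) (p : F[X]) (g : σ → F[X]) :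
    p ∣ MvPolynomial.aeval (fun i ↦ g i % p) q ↔ p ∣ MvPolynomial.aeval g q := by
  have key : ∀ h : σ → F[X], AdjoinRoot.mk p (MvPolynomial.aeval h q) =
      MvPolynomial.aeval (fun i ↦ AdjoinRoot.mk p (h i)) q := fun h ↦
    (comp_aeval_apply h (AdjoinRoot.mkₐ p) q).symm ▸ rfl
  have hmod : ∀ f : F[X], AdjoinRoot.mk p (f % p) = AdjoinRoot.mk p f := fun f ↦ by
    rw [eq_comm, AdjoinRoot.mk_eq_mk]
    exact ⟨f / p, by rw [sub_eq_iff_eq_add, EuclideanDomain.div_add_mod]⟩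
  simp_rw [← AdjoinRoot.mk_eq_zero, key, hmod]

variable {σ F : Type*} [Fintype σ]

theorem IsHomogeneous.sum_eq_of_mem_support {R : Type*} [CommSemiring R]
    {q : MvPolynomial σ R} {d : ℕ} (hq : q.IsHomogeneous d) {e : σ →₀ ℕ} (he : e ∈ q.support) :
    ∑ i, e i = d := by
  rw [← Finsupp.degree_eq_sum]
  by_contra h
  exact mem_support_iff.1 he (hq.coeff_eq_zero h)

theorem IsHomogeneous.aeval_mul {R A : Type*} [CommSemiring R] [CommSemiring A] [Algebra R A]
    {q : MvPolynomial σ R} {d : ℕ} (hq : q.IsHomogeneous d) (c : A) (y : σ → A) :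
    MvPolynomial.aeval (fun i ↦ c * y i) q = c ^ d * MvPolynomial.aeval y q := by
  simp only [aeval_def, eval₂_eq', Finset.mul_sum]
  refine Finset.sum_congr rfl fun e he ↦ ?_
  simp only [mul_pow, Finset.prod_mul_distrib, Finset.prod_pow_eq_pow_sum,
    hq.sum_eq_of_mem_support he]
  ring

theorem IsHomogeneous.natDegree_aeval_le_and_coeff {R : Type*} [CommSemiring R]
    {q : MvPolynomial σ R} {d : ℕ} (hq : q.IsHomogeneous d) (g : σ → R[X]) {m : ℕ}
    (hg : ∀ i, (g i).natDegree ≤ m) :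
    (MvPolynomial.aeval g q).natDegree ≤ d * m ∧
      (MvPolynomial.aeval g q).coeff (d * m) = MvPolynomial.aeval (fun i ↦ (g i).coeff m) q := by
  simp only [aeval_def, eval₂_eq', Polynomial.algebraMap_eq,
    finsetSum_coeff, Polynomial.coeff_C_mul, Algebra.algebraMap_self, RingHom.id_apply]
  constructor
  · refine natDegree_sum_le_of_forall_le _ _ fun e he ↦ (natDegree_C_mul_le _ _).trans ?_
    simpa [hq.sum_eq_of_mem_support he] using (natDegree_prod_pow_le_and_coeff Finset.univ g e hg).1
  · refine Finset.sum_congr rfl fun e he ↦ ?_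
    rw [← (natDegree_prod_pow_le_and_coeff Finset.univ g e hg).2, hq.sum_eq_of_mem_support he]

/-- An anisotropic quadratic form stays anisotropic modulo irreducible polynomials of odd
degree. -/
theorem IsHomogeneous.dvd_of_dvd_aeval_of_odd_natDegree [Field F] {q : MvPolynomial σ F}
    (hq : q.IsHomogeneous 2) (han : ∀ y : σ → F, MvPolynomial.aeval y q = 0 → y = 0) {p : F[X]}
    (hp : Irreducible p) (hodd : Odd p.natDegree) (g : σ → F[X])
    (hdvd : p ∣ MvPolynomial.aeval g q) :
    ∀ i, p ∣ g i := by
  classical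
  induction hN : p.natDegree using Nat.strong_induction_on generalizing p g with
  | _ N ih =>
  subst hN
  by_contra! ⟨i₀, hi₀⟩
  set f : σ → F[X] := fun i ↦ g i % p with hf
  have hfdvd : p ∣ MvPolynomial.aeval f q := (dvd_aeval_mod_iff q p g).2 hdvd
  have hfi₀ : f i₀ ≠ 0 := fun h ↦ hi₀ (EuclideanDomain.mod_eq_zero.1 h)
  have hfdeg : ∀ i, (f i).natDegree < p.natDegree := fun i ↦
    natDegree_mod_lt _ hodd.pos.ne'
  obtain ⟨h, hfh, hgcd⟩ := Finset.univ.extract_gcd f ⟨i₀, Finset.mem_univ _⟩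
  simp only [Finset.mem_univ, true_imp_iff] at hfh
  set c := Finset.univ.gcd f
  have hc : c ≠ 0 := fun hc ↦ hfi₀ (by rw [hfh, hc, zero_mul])
  have hpc : ¬ p ∣ c := fun hpc ↦ by
    have := natDegree_le_of_dvd (hpc.trans ⟨_, hfh i₀⟩) hfi₀
    exact absurd (hfdeg i₀) (by omega)
  have hhdeg : ∀ i, (h i).natDegree < p.natDegree := fun i ↦ by
    by_cases hi : h i = 0
    · simpa [hi] using hodd.pos
    · refine lt_of_le_of_lt ?_ (hfdeg i)
      rw [hfh, natDegree_mul hc hi]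
      omega
  have hhdvd : p ∣ MvPolynomial.aeval h q := by
    rw [_root_.funext hfh, hq.aeval_mul] at hfdvd
    exact (hp.prime.dvd_or_dvd hfdvd).resolve_left fun h ↦ hpc (hp.prime.dvd_of_dvd_pow h)
  obtain ⟨j, -, hj⟩ := Finset.exists_max_image Finset.univ (fun i ↦ (h i).natDegree)
    ⟨i₀, Finset.mem_univ _⟩
  set m := (h j).natDegree with hm
  have hmlt : m < p.natDegree := hhdeg j
  have hle : ∀ i, (h i).natDegree ≤ m := fun i ↦ hj i (Finset.mem_univ _)
  obtain ⟨hqle, hqcoeff⟩ := hq.natDegree_aeval_le_and_coeff h hle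
  have hne : (MvPolynomial.aeval h q).coeff (2 * m) ≠ 0 := fun h0 ↦ by
    have hj0 : h j = 0 := leadingCoeff_eq_zero.1 (congrFun (han _ (hqcoeff ▸ h0)) j)
    have hm0 : m = 0 := by simp [hm, hj0]
    have hz : ∀ i, h i = 0 := fun i ↦ by
      have := congrFun (han _ (hqcoeff ▸ h0)) i
      have hi := hle i
      rw [hm0] at this hi
      rw [eq_C_of_natDegree_le_zero hi]
      simpa using this
    exact hfi₀ (by rw [hfh, hz, mul_zero])
  have hqdeg : (MvPolynomial.aeval h q).natDegree = 2 * m :=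
    le_antisymm hqle (le_natDegree_of_ne_zero hne)
  obtain ⟨r, hr⟩ := hhdvd
  have hr0 : r ≠ 0 := by
    rintro rfl
    simp [hr] at hne
  rw [hr, natDegree_mul hp.ne_zero hr0] at hqdeg
  obtain ⟨p', hp', hp'r, hp'odd⟩ := exists_irreducible_dvd_odd_natDegree (f := r) (by grind)
  have hlt : p'.natDegree < p.natDegree := by
    have := natDegree_le_of_dvd hp'r hr0
    omega
  have hall := ih _ hlt hp' hp'odd h (hr ▸ hp'r.mul_left p) rfl
  exact hp'.not_isUnit (isUnit_of_dvd_one (hgcd ▸ Finset.dvd_gcd fun i _ ↦ hall i))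

open IntermediateField in
theorem IsHomogeneous.eq_zero_of_aeval_adjoin_simple {E : Type*} [Field F] [Field E] [Algebra F E]
    {q : MvPolynomial σ F} (hq : q.IsHomogeneous 2)
    (han : ∀ y : σ → F, MvPolynomial.aeval y q = 0 → y = 0)
    {x : E} (hx : IsIntegral F x) (hodd : Odd (Module.finrank F F⟮x⟯)) (y : σ → F⟮x⟯)
    (hy : MvPolynomial.aeval y q = 0) : y = 0 := by
  rw [adjoin.finrank hx] at hodd
  choose g hg using fun i ↦ (adjoin.powerBasis hx).exists_eq_aeval' (y i)
  rw [adjoin.powerBasis_gen] at hg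
  have hmin := minpoly_gen F x
  have hdvd : minpoly F x ∣ MvPolynomial.aeval g q := by
    rw [← hmin]
    refine minpoly.dvd _ _ ?_
    rw [comp_aeval_apply, ← hy]
    exact congrArg (fun z ↦ MvPolynomial.aeval z q) (_root_.funext fun i ↦ (hg i).symm)
  funext i
  obtain ⟨k, hk⟩ := hq.dvd_of_dvd_aeval_of_odd_natDegree han (minpoly.irreducible hx) hodd g hdvd i
  rw [hg i, hk, ← hmin, map_mul, minpoly.aeval, zero_mul, Pi.zero_apply]

open IntermediateField in
theorem IsHomogeneous.eq_zero_of_aeval_of_odd_finrank {K L : Type*} [Field K] [Field L]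
    [Algebra K L] [FiniteDimensional K L] (hodd : Odd (Module.finrank K L))
    {q : MvPolynomial σ K} (hq : q.IsHomogeneous 2)
    (han : ∀ y : σ → K, MvPolynomial.aeval y q = 0 → y = 0) (M : IntermediateField K L) (y : σ → M)
    (hy : MvPolynomial.aeval y q = 0) : y = 0 := by
  induction M using induction_on_adjoin with
  | base =>
    have h := han (fun i ↦ botEquiv K L (y i)) <| by
      have := comp_aeval_apply y (botEquiv K L).toAlgHom q
      rw [hy, map_zero] at this
      exact this.symm
    funext i
    exact (botEquiv K L).injective (by simpa using congrFun h i)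
  | ih M x ih =>
    have h1 : Odd (Module.finrank M M⟮x⟯) := by
      refine hodd.of_dvd_nat ((Dvd.intro _ (Module.finrank_mul_finrank M M⟮x⟯ L)).trans
        (Dvd.intro_left _ (Module.finrank_mul_finrank K M L)))
    refine (hq.map (algebraMap K M)).eq_zero_of_aeval_adjoin_simple
      (fun z hz ↦ ih z (by rwa [aeval_map_algebraMap] at hz)) (.of_finite M x) h1 y ?_
    exact (aeval_map_algebraMap M (B := M⟮x⟯) y q).trans hy

end MvPolynomial

/-- Springer's theorem: if a quadratic form (a homogeneous polynomial of degree 2) over a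
field `K` has a nontrivial zero over a finite extension `L` of odd degree, then it has a
nontrivial zero over `K`. -/
theorem stmt_3 {K L : Type*} [Field K] [Field L] [Algebra K L] [FiniteDimensional K L]
    (hodd : Odd (Module.finrank K L)) (n : ℕ) (q : MvPolynomial (Fin n) K)
    (hq : q.IsHomogeneous 2)
    (hL : ∃ x : Fin n → L, x ≠ 0 ∧ MvPolynomial.aeval x q = 0) :
    ∃ x : Fin n → K, x ≠ 0 ∧ MvPolynomial.eval x q = 0 := by
  by_contra! han
  obtain ⟨x, hx, hx0⟩ := hL
  have key := hq.eq_zero_of_aeval_of_odd_finrank hodd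
    (fun y hy ↦ by_contra fun h ↦ han y h (by rwa [← MvPolynomial.aeval_eq_eval]))
    ⊤ (fun i ↦ (IntermediateField.topEquiv (F := K) (E := L)).symm (x i)) <| by
      have := MvPolynomial.comp_aeval_apply x
        (IntermediateField.topEquiv (F := K) (E := L)).symm.toAlgHom q
      rw [hx0, map_zero] at this
      exact this.symm
  refine hx (funext fun i ↦ (IntermediateField.topEquiv (F := K) (E := L)).symm.injective ?_)
  simpa using congrFun key i
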